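/- arXiv:math/9906205 — 5 statements merged into one kernel-verified Lean document; each statement's English description precedes it below -/
import Mathlib

section
/- (Extension Axiom.) Under the hypotheses listed in the context, if every bounded subset of ker p is bornopotent (with respect to the bornology of A) and every bounded subset of B is bornopotent, then every bounded subset of A is bornopotent. In the paper's terminology: in an extension of bornological algebras whose kernel and quotient are analytically nilpotent, the middle algebra is analytically nilpotent. -/
open scoped Pointwise

/-- Closure under absolutely convex combinations of two points. -/
def AbsConvexComb {A : Type*} [AddCommGroup A] [Module ℂ A] (T : Set A) : Prop :=
  ∀ x ∈ T, ∀ y ∈ T, ∀ a b : ℂ, ‖a‖ + ‖b‖ ≤ 1 → a • x + b • y ∈ T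

/-- The smallest set containing `G` which is closed under absolutely convex combinations. -/
def absConvexCombHull {A : Type*} [AddCommGroup A] [Module ℂ A] (G : Set A) : Set A :=
  {y | ∀ T : Set A, AbsConvexComb T → G ⊆ T → y ∈ T}

section Hull

variable {A : Type*} [AddCommGroup A] [Module ℂ A] {G T : Set A}

theorem subset_absConvexCombHull : G ⊆ absConvexCombHull G :=
  fun _ hx _ _ hG => hG hx

theorem absConvexComb_absConvexCombHull : AbsConvexComb (absConvexCombHull G) :=
  fun x hx y hy a b hab T hT hG => hT x (hx T hT hG) y (hy T hT hG) a b hab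

theorem absConvexCombHull_subset (hT : AbsConvexComb T) (hG : G ⊆ T) :
    absConvexCombHull G ⊆ T :=
  fun _ hy => hy T hT hG

theorem AbsConvexComb.third_smul_add_add_mem (hT : AbsConvexComb T) {x y z : A}
    (hx : x ∈ T) (hy : y ∈ T) (hz : z ∈ T) : (1 / 3 : ℂ) • (x + y + z) ∈ T := by
  have h1 := hT x hx y hy (1 / 2) (1 / 2) (by norm_num)
  have h2 := hT _ h1 z hz (2 / 3) (1 / 3) (by norm_num)
  convert h2 using 1
  module

theorem AbsConvexComb.third_smul_add_mem (hT : AbsConvexComb T) {x y : A}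
    (hx : x ∈ T) (hy : y ∈ T) : (1 / 3 : ℂ) • (x + y) ∈ T := by
  rw [smul_add]
  exact hT x hx y hy _ _ (by norm_num)

end Hull

/-- If each `s ∈ S` lies in the hull of `G` and maps `G` into that hull by left multiplication,
then so does every element of the semigroup generated by `S`. -/
theorem closure_subset_absConvexCombHull {A : Type*} [NonUnitalRing A] [Module ℂ A]
    [SMulCommClass ℂ A A] {S G : Set A} (hS : S ⊆ absConvexCombHull G)
    (hSG : ∀ s ∈ S, ∀ g ∈ G, s * g ∈ absConvexCombHull G) :
    ((Subsemigroup.closure S : Subsemigroup A) : Set A) ⊆ absConvexCombHull G := by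
  have key : ∀ y ∈ Subsemigroup.closure S,
      y ∈ absConvexCombHull G ∧ ∀ x ∈ absConvexCombHull G, y * x ∈ absConvexCombHull G := by
    intro y hy
    induction hy using Subsemigroup.closure_induction with
    | mem s hs =>
      refine ⟨hS hs, fun x hx => ?_⟩
      refine absConvexCombHull_subset (T := {x | s * x ∈ absConvexCombHull G}) ?_ (hSG s hs) hx
      intro u hu v hv a b hab
      simp only [Set.mem_ofPred_eq, mul_add, mul_smul_comm]
      exact absConvexComb_absConvexCombHull _ hu _ hv a b hab
    | mul x y _ _ hx hy =>
      refine ⟨hx.2 y hy.1, fun z hz => ?_⟩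
      rw [mul_assoc]
      exact hx.2 _ (hy.2 z hz)
  exact fun y hy => (key y hy).1

/-- Suppose `f * g` lies in `F + K` for all `f, g ∈ F`. Left multiplication by `F` sends the
semigroup `N` generated by `0`, `L` and `F * L`, where `K ⊆ L`, into `N + N`. -/
theorem mul_mem_closure_add_closure {A : Type*} [NonUnitalRing A] {F K L : Set A} (hKL : K ⊆ L)
    (hFF : ∀ f ∈ F, ∀ g ∈ F, ∃ h ∈ F, ∃ k ∈ K, f * g = h + k) {f n : A} (hf : f ∈ F)
    (hn : n ∈ Subsemigroup.closure ({0} ∪ (L ∪ F * L))) :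
    ∃ u ∈ Subsemigroup.closure ({0} ∪ (L ∪ F * L)),
      ∃ v ∈ Subsemigroup.closure ({0} ∪ (L ∪ F * L)), f * n = u + v := by
  have hzero : (0 : A) ∈ Subsemigroup.closure ({0} ∪ (L ∪ F * L)) :=
    Subsemigroup.subset_closure (Or.inl rfl)
  have hL : ∀ l ∈ L, l ∈ Subsemigroup.closure ({0} ∪ (L ∪ F * L)) :=
    fun l hl => Subsemigroup.subset_closure (Or.inr (Or.inl hl))
  have hFL : ∀ g ∈ F, ∀ l ∈ L, g * l ∈ Subsemigroup.closure ({0} ∪ (L ∪ F * L)) :=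
    fun g hg l hl => Subsemigroup.subset_closure (Or.inr (Or.inr (Set.mul_mem_mul hg hl)))
  induction hn using Subsemigroup.closure_induction with
  | mem x hx =>
    rcases hx with rfl | hx | ⟨g, hg, l, hl, rfl⟩
    · exact ⟨0, hzero, 0, hzero, by simp⟩
    · exact ⟨f * x, hFL f hf x hx, 0, hzero, by simp⟩
    · obtain ⟨h, hh, k, hk, e⟩ := hFF f hf g hg
      refine ⟨h * l, hFL h hh l hl, k * l, mul_mem (hL k (hKL hk)) (hL l hl), ?_⟩
      change f * (g * l) = _
      rw [← mul_assoc, e, add_mul]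
  | mul x y _ hy hx _ =>
    obtain ⟨u, hu, v, hv, e⟩ := hx
    exact ⟨u * y, mul_mem hu hy, v * y, mul_mem hv hy, by rw [← mul_assoc, e, add_mul]⟩

/-- **Extension Axiom.**  `A` and `B` are (not necessarily unital)
`ℂ`-algebras equipped with bornologies `𝔄`, `𝔅` (collections of "bounded" sets closed
under subsets, finite unions, containing all finite sets, closed under `S + T`, `S * T`,
scalar multiples, and such that every bounded set is contained in a bounded absolutely
convex set).  `p : A → B` is a surjective algebra homomorphism that is bounded and such
that every bounded subset of `B` lifts to a bounded subset of `A`.  A set `S` is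
*bornopotent* when `S^∞`, the underlying set of the subsemigroup generated by `S`, is
bounded.  If every bounded subset of `ker p` and every bounded subset of `B` is
bornopotent, then every bounded subset of `A` is bornopotent.  -/
theorem extension_axiom
    {A B : Type*} [NonUnitalRing A] [Module ℂ A] [SMulCommClass ℂ A A] [IsScalarTower ℂ A A]
    [NonUnitalRing B] [Module ℂ B] [SMulCommClass ℂ B B] [IsScalarTower ℂ B B]
    (𝔄 : Set (Set A)) (𝔅 : Set (Set B))
    (hA_down : ∀ S T : Set A, S ∈ 𝔄 → T ⊆ S → T ∈ 𝔄)
    (hA_union : ∀ S T : Set A, S ∈ 𝔄 → T ∈ 𝔄 → S ∪ T ∈ 𝔄)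
    (hA_fin : ∀ S : Set A, S.Finite → S ∈ 𝔄)
    (hA_add : ∀ S T : Set A, S ∈ 𝔄 → T ∈ 𝔄 → S + T ∈ 𝔄)
    (hA_mul : ∀ S T : Set A, S ∈ 𝔄 → T ∈ 𝔄 → S * T ∈ 𝔄)
    (hA_smul : ∀ (c : ℂ) (S : Set A), S ∈ 𝔄 → c • S ∈ 𝔄)
    (hA_disk : ∀ S ∈ 𝔄, ∃ T ∈ 𝔄, S ⊆ T ∧
      ∀ x ∈ T, ∀ y ∈ T, ∀ a b : ℂ, ‖a‖ + ‖b‖ ≤ 1 → a • x + b • y ∈ T)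
    (hB_down : ∀ S T : Set B, S ∈ 𝔅 → T ⊆ S → T ∈ 𝔅)
    (hB_union : ∀ S T : Set B, S ∈ 𝔅 → T ∈ 𝔅 → S ∪ T ∈ 𝔅)
    (hB_fin : ∀ S : Set B, S.Finite → S ∈ 𝔅)
    (hB_add : ∀ S T : Set B, S ∈ 𝔅 → T ∈ 𝔅 → S + T ∈ 𝔅)
    (hB_mul : ∀ S T : Set B, S ∈ 𝔅 → T ∈ 𝔅 → S * T ∈ 𝔅)
    (hB_smul : ∀ (c : ℂ) (S : Set B), S ∈ 𝔅 → c • S ∈ 𝔅)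
    (hB_disk : ∀ S ∈ 𝔅, ∃ T ∈ 𝔅, S ⊆ T ∧
      ∀ x ∈ T, ∀ y ∈ T, ∀ a b : ℂ, ‖a‖ + ‖b‖ ≤ 1 → a • x + b • y ∈ T)
    (p : A → B)
    (hp_add : ∀ x y, p (x + y) = p x + p y)
    (hp_smul : ∀ (c : ℂ) (x : A), p (c • x) = c • p x)
    (hp_mul : ∀ x y, p (x * y) = p x * p y)
    (hp_surj : Function.Surjective p)
    (hp_bounded : ∀ S ∈ 𝔄, p '' S ∈ 𝔅)
    (hp_lift : ∀ T ∈ 𝔅, ∃ S ∈ 𝔄, p '' S = T)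
    (hker : ∀ S ∈ 𝔄, (∀ x ∈ S, p x = 0) →
      ((Subsemigroup.closure S : Subsemigroup A) : Set A) ∈ 𝔄)
    (hquot : ∀ T ∈ 𝔅, ((Subsemigroup.closure T : Subsemigroup B) : Set B) ∈ 𝔅) :
    ∀ S ∈ 𝔄, ((Subsemigroup.closure S : Subsemigroup A) : Set A) ∈ 𝔄 := by
  intro S hS
  obtain ⟨F, hF, hpF⟩ := hp_lift _ (hquot _ (hp_bounded _ (hA_smul 3 S hS)))
  have hpF_mem : ∀ f ∈ F, p f ∈ Subsemigroup.closure (p '' ((3 : ℂ) • S)) := fun f hf => by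
    rw [← SetLike.mem_coe, ← hpF]
    exact Set.mem_image_of_mem p hf
  let K : Set A := {x | p x = 0} ∩ ((F * F + (-1 : ℂ) • F) ∪ ((3 : ℂ) • S + (-1 : ℂ) • F))
  have hp_sub : ∀ x y, p x = p y → p (x + (-1 : ℂ) • y) = 0 := fun x y h => by
    rw [hp_add, hp_smul, h]
    module
  have hp_zero : p 0 = 0 := by simpa using hp_smul 0 0
  have hFF : ∀ f ∈ F, ∀ g ∈ F, ∃ h ∈ F, ∃ k ∈ K, f * g = h + k := by
    intro f hf g hg
    have hfg : p (f * g) ∈ p '' F := by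
      rw [hpF, hp_mul]
      exact mul_mem (hpF_mem f hf) (hpF_mem g hg)
    obtain ⟨h, hh, e⟩ := hfg
    exact ⟨h, hh, f * g + (-1 : ℂ) • h, ⟨hp_sub _ _ e.symm, Or.inl
      (Set.add_mem_add (Set.mul_mem_mul hf hg) (Set.smul_mem_smul_set hh))⟩, by module⟩
  have hSF : ∀ s ∈ S, ∃ h ∈ F, ∃ k ∈ K, s = (1 / 3 : ℂ) • (h + k) := by
    intro s hs
    have hs3 : (3 : ℂ) • s ∈ (3 : ℂ) • S := Set.smul_mem_smul_set hs
    have hps : p ((3 : ℂ) • s) ∈ p '' F := by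
      rw [hpF]
      exact Subsemigroup.subset_closure (Set.mem_image_of_mem p hs3)
    obtain ⟨h, hh, e⟩ := hps
    exact ⟨h, hh, (3 : ℂ) • s + (-1 : ℂ) • h, ⟨hp_sub _ _ e.symm, Or.inr
      (Set.add_mem_add hs3 (Set.smul_mem_smul_set hh))⟩, by module⟩
  have hF' := hA_smul (-1) F hF
  have hK : K ∈ 𝔄 := hA_down _ _ (hA_union _ _ (hA_add _ _ (hA_mul _ _ hF hF) hF')
    (hA_add _ _ (hA_smul 3 S hS) hF')) Set.inter_subset_right
  let L : Set A := K ∪ K * F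
  have hL : L ∈ 𝔄 := hA_union _ _ hK (hA_mul _ _ hK hF)
  have hpL : ∀ l ∈ L, p l = 0 := by
    rintro l (hl | ⟨k, hk, f, -, rfl⟩)
    · exact hl.1
    · exact (hp_mul k f).trans (by rw [hk.1, zero_mul])
  let N := Subsemigroup.closure ({0} ∪ (L ∪ F * L))
  have hN : (N : Set A) ∈ 𝔄 := by
    refine hker _ (hA_union _ _ (hA_fin _ (Set.finite_singleton 0))
      (hA_union _ _ hL (hA_mul _ _ hF hL))) ?_
    rintro x (rfl | hx | ⟨f, -, l, hl, rfl⟩)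
    · exact hp_zero
    · exact hpL x hx
    · exact (hp_mul f l).trans (by rw [hpL l hl, mul_zero])
  have hLN : ∀ l ∈ L, l ∈ N := fun l hl => Subsemigroup.subset_closure (Or.inr (Or.inl hl))
  obtain ⟨D, hD, hGD, hDconv⟩ := hA_disk _ (hA_union _ _ hF hN)
  refine hA_down _ _ hD (Set.Subset.trans ?_ (absConvexCombHull_subset hDconv hGD))
  have hFX : ∀ f ∈ F, f ∈ absConvexCombHull (F ∪ N) :=
    fun f hf => subset_absConvexCombHull (Or.inl hf)
  have hNX : ∀ n ∈ N, n ∈ absConvexCombHull (F ∪ N) :=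
    fun n hn => subset_absConvexCombHull (Or.inr hn)
  refine closure_subset_absConvexCombHull (fun s hs => ?_) (fun s hs g hg => ?_)
  · obtain ⟨f, hf, k, hk, rfl⟩ := hSF s hs
    exact absConvexComb_absConvexCombHull.third_smul_add_mem (hFX f hf) (hNX k (hLN k (Or.inl hk)))
  · obtain ⟨f, hf, k, hk, rfl⟩ := hSF s hs
    rw [smul_mul_assoc, add_mul]
    rcases hg with hg | hg
    · obtain ⟨h, hh, k', hk', e⟩ := hFF f hf g hg
      rw [e]
      exact absConvexComb_absConvexCombHull.third_smul_add_add_mem (hFX h hh)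
        (hNX k' (hLN k' (Or.inl hk'))) (hNX _ (hLN _ (Or.inr (Set.mul_mem_mul hk hg))))
    · obtain ⟨u, hu, v, hv, e⟩ := mul_mem_closure_add_closure Set.subset_union_left hFF hf hg
      rw [e]
      exact absConvexComb_absConvexCombHull.third_smul_add_add_mem (hNX u hu) (hNX v hv)
        (hNX _ (mul_mem (hLN k (Or.inl hk)) hg))
end

section
/- Let S be a set of infinitely differentiable functions f : ℝ → ℂ such that for every k ∈ ℕ one has sup_{f ∈ S} sup_{t ∈ [0,1]} |f^{(k)}(t)| < ∞ (i.e. S is bounded in every C^k-seminorm on [0,1]). Then there exists λ > 0 such that the set ({λ·f : f ∈ S})^∞ is again bounded in every C^k-seminorm on [0,1]; that is, for every k ∈ ℕ, sup_{g ∈ ({λ·f : f ∈ S})^∞} sup_{t ∈ [0,1]} |g^{(k)}(t)| < ∞. In fact any λ > 0 with λ · sup_{f ∈ S} sup_{t ∈ [0,1]} |f(t)| ≤ 1/2 works. -/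
open scoped Pointwise

/-- **Uniform derivative bounds on a multiplicative closure.** If a set `T` of smooth functions is
uniformly bounded by `r < 1` on `I` and each of its derivatives is uniformly bounded on `I`, then
the derivatives are uniformly bounded on `I` over the subsemigroup generated by `T`. -/
theorem exists_norm_iteratedDeriv_le_of_mem_subsemigroup_closure
    {𝕜 A : Type*} [NontriviallyNormedField 𝕜] [NormedRing A] [NormedAlgebra 𝕜 A]
    {T : Set (𝕜 → A)} {I : Set 𝕜} {r : ℝ} (hr : r < 1)
    (hsmooth : ∀ f ∈ T, ContDiff 𝕜 (⊤ : ℕ∞) f)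
    (hbdd : ∀ k : ℕ, ∃ C : ℝ, ∀ f ∈ T, ∀ t ∈ I, ‖iteratedDeriv k f t‖ ≤ C)
    (hle : ∀ f ∈ T, ∀ t ∈ I, ‖f t‖ ≤ r) (k : ℕ) :
    ∃ C : ℝ, ∀ g ∈ Subsemigroup.closure T, ∀ t ∈ I, ‖iteratedDeriv k g t‖ ≤ C := by
  have hsmooth' : ∀ g ∈ Subsemigroup.closure T, ContDiff 𝕜 (⊤ : ℕ∞) g := fun g hg ↦ by
    induction hg using Subsemigroup.closure_induction with
    | mem f hf => exact hsmooth f hf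
    | mul f g _ _ hf hg => exact hf.mul hg
  choose M hM using hbdd
  induction k using Nat.strong_induction_on with
  | _ k ih =>
  choose! D hD using ih
  set a : ℝ := ∑ i ∈ Finset.range k, (k.choose (i + 1) : ℝ) * M (i + 1) * D (k - (i + 1))
  set C : ℝ := max (M k) (a / (1 - r))
  have haC : r * C + a ≤ C := by
    have h : a / (1 - r) ≤ C := le_max_right _ _
    rw [div_le_iff₀ (by linarith)] at h
    linarith
  have hstep : ∀ f ∈ T, ∀ g ∈ Subsemigroup.closure T, (∀ t ∈ I, ‖iteratedDeriv k g t‖ ≤ C) →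
      ∀ t ∈ I, ‖iteratedDeriv k (f * g) t‖ ≤ C := by
    intro f hf g hg hgC t ht
    have leibniz := norm_iteratedFDeriv_mul_le (hsmooth f hf) (hsmooth' g hg) t (n := k)
      (by exact_mod_cast le_top)
    simp only [norm_iteratedFDeriv_eq_norm_iteratedDeriv] at leibniz
    rw [Finset.sum_range_succ'] at leibniz
    simp only [Nat.choose_zero_right, Nat.cast_one, one_mul, iteratedDeriv_zero,
      Nat.sub_zero] at leibniz
    have hlow : ∑ i ∈ Finset.range k, (k.choose (i + 1) : ℝ) * ‖iteratedDeriv (i + 1) f t‖ *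
        ‖iteratedDeriv (k - (i + 1)) g t‖ ≤ a := by
      refine Finset.sum_le_sum fun i hi ↦ ?_
      have hfM := hM (i + 1) f hf t ht
      have hM0 : 0 ≤ M (i + 1) := (norm_nonneg _).trans hfM
      have hgD := hD (k - (i + 1)) (by have := Finset.mem_range.1 hi; omega) g hg t ht
      gcongr
    have htop : ‖f t‖ * ‖iteratedDeriv k g t‖ ≤ r * C :=
      mul_le_mul (hle f hf t ht) (hgC t ht) (norm_nonneg _) ((norm_nonneg _).trans (hle f hf t ht))
    exact leibniz.trans (by linarith)
  refine ⟨C, fun g hg ↦ And.left (b := ∀ h ∈ Subsemigroup.closure T,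
    (∀ t ∈ I, ‖iteratedDeriv k h t‖ ≤ C) → ∀ t ∈ I, ‖iteratedDeriv k (g * h) t‖ ≤ C) ?_⟩
  induction hg using Subsemigroup.closure_induction with
  | mem f hf => exact ⟨fun t ht ↦ (hM k f hf t ht).trans (le_max_left _ _), hstep f hf⟩
  | mul f g _ hg hfC hgC =>
    refine ⟨hfC.2 g hg hgC.1, fun h hh hhC ↦ ?_⟩
    rw [mul_assoc]
    exact hfC.2 _ (mul_mem hg hh) (hgC.2 h hh hhC)

/-- **Homotopy Axiom: `C^∞([0,1])` is tensoring.** Let `S` be a set of smooth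
functions `ℝ → ℂ` which is bounded in every `C^k`-seminorm on `[0,1]`.  Then there is
`c > 0` such that `((c • S))^∞` (the multiplicative subsemigroup generated by the rescaled
set) is again bounded in every `C^k`-seminorm on `[0,1]`; in fact any `c > 0` with
`c * sup_{f ∈ S} sup_{t ∈ [0,1]} |f t| ≤ 1/2` works. -/
theorem smooth_functions_tensoring
    (S : Set (ℝ → ℂ))
    (hsmooth : ∀ f ∈ S, ContDiff ℝ (⊤ : ℕ∞) f)
    (hbdd : ∀ k : ℕ, ∃ C : ℝ, ∀ f ∈ S, ∀ t ∈ Set.Icc (0 : ℝ) 1, ‖iteratedDeriv k f t‖ ≤ C) :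
    (∃ c : ℝ, 0 < c ∧ ∀ k : ℕ, ∃ C : ℝ,
      ∀ g ∈ ((Subsemigroup.closure ((c : ℂ) • S) : Subsemigroup (ℝ → ℂ)) : Set (ℝ → ℂ)),
        ∀ t ∈ Set.Icc (0 : ℝ) 1, ‖iteratedDeriv k g t‖ ≤ C) ∧
    (∀ c : ℝ, 0 < c → (∀ f ∈ S, ∀ t ∈ Set.Icc (0 : ℝ) 1, c * ‖f t‖ ≤ 1 / 2) →
      ∀ k : ℕ, ∃ C : ℝ,
        ∀ g ∈ ((Subsemigroup.closure ((c : ℂ) • S) : Subsemigroup (ℝ → ℂ)) : Set (ℝ → ℂ)),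
          ∀ t ∈ Set.Icc (0 : ℝ) 1, ‖iteratedDeriv k g t‖ ≤ C) := by
  have main : ∀ c : ℝ, 0 < c → (∀ f ∈ S, ∀ t ∈ Set.Icc (0 : ℝ) 1, c * ‖f t‖ ≤ 1 / 2) →
      ∀ k : ℕ, ∃ C : ℝ,
        ∀ g ∈ ((Subsemigroup.closure ((c : ℂ) • S) : Subsemigroup (ℝ → ℂ)) : Set (ℝ → ℂ)),
          ∀ t ∈ Set.Icc (0 : ℝ) 1, ‖iteratedDeriv k g t‖ ≤ C := by
    intro c hc hle
    refine exists_norm_iteratedDeriv_le_of_mem_subsemigroup_closure one_half_lt_one ?_ ?_ ?_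
    · rintro _ ⟨f, hf, rfl⟩
      exact (hsmooth f hf).const_smul (c : ℂ)
    · intro k
      obtain ⟨C, hC⟩ := hbdd k
      refine ⟨c * C, ?_⟩
      rintro _ ⟨f, hf, rfl⟩ t ht
      simp only [iteratedDeriv_const_smul_field, norm_smul, Complex.norm_real,
        Real.norm_of_nonneg hc.le]
      exact mul_le_mul_of_nonneg_left (hC f hf t ht) hc.le
    · rintro _ ⟨f, hf, rfl⟩ t ht
      simpa [abs_of_pos hc] using hle f hf t ht
  refine ⟨?_, main⟩
  obtain ⟨C, hC⟩ := hbdd 0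
  have hpos : 0 < 2 * (|C| + 1) := by positivity
  refine ⟨1 / (2 * (|C| + 1)), by positivity, main _ (by positivity) fun f hf t ht ↦ ?_⟩
  have hfC : ‖f t‖ ≤ C := by simpa using hC f hf t ht
  rw [one_div_mul_eq_div, div_le_iff₀ hpos]
  linarith [le_abs_self C]
end

section
/- Let A be an associative, not necessarily unital, ℂ-algebra, n ≥ 1, and ∇ : Ωⁿ A → Ω^{n+1} A a linear map with ∇(a·ω) = a·∇(ω) and ∇(ω·a) = ∇(ω)·a + (−1)ⁿ ω da for all a ∈ A, ω ∈ Ωⁿ A. Extend ∇ to all of Ω A by ∇(ω da_{n+1} ⋯ da_j) := ∇(ω) da_{n+1} ⋯ da_j for ω ∈ Ωⁿ A and j > n, and ∇ := 0 on Ω^j A for j < n. Then the operator [b, ∇] := b ∘ ∇ + ∇ ∘ b on Ω A is an idempotent whose range is exactly Fₙ(A) := b(Ω^{n+1} A) ⊕ ⊕_{j ≥ n+1} Ω^j A; moreover [b, ∇] = id on Fₙ(A), and its kernel is a b-invariant linear complement of Fₙ(A) in Ω A. -/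
open scoped TensorProduct

/-- The differential graded algebra `Ω A` of noncommutative differential forms over the
(not necessarily unital) `ℂ`-algebra `A`, presented through its canonical structure:
a (non-unital) `ℂ`-algebra graded by subspaces `deg n` (with `deg n` corresponding to
`Ωⁿ A = Ã ⊗ A^{⊗n}`), `Ω⁰ A = A` embedded via the injective algebra map `ι`, the
differential `d` with `d ∘ d = 0` and the graded Leibniz rule, the defining recursion
`(d a)·y = d (a·y) − a·(d y)` for `a, y ∈ A`, and every `Ω^{n+1} A` spanned by the
elementary forms `ã₀ da₁ ⋯ da_{n+1}`. -/
structure Forms (A : Type) [NonUnitalRing A] [Module ℂ A]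
    [SMulCommClass ℂ A A] [IsScalarTower ℂ A A] : Type 1 where
  Ω : Type
  [ringΩ : NonUnitalRing Ω]
  [modΩ : Module ℂ Ω]
  [smulCommΩ : SMulCommClass ℂ Ω Ω]
  [towerΩ : IsScalarTower ℂ Ω Ω]
  deg : ℕ → Submodule ℂ Ω
  internal : DirectSum.IsInternal deg
  mul_mem' : ∀ {m n : ℕ} {x y : Ω}, x ∈ deg m → y ∈ deg n → x * y ∈ deg (m + n)
  ι : A →ₗ[ℂ] Ω
  ι_injective : Function.Injective ι
  ι_mul : ∀ a b : A, ι (a * b) = ι a * ι b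
  deg_zero : deg 0 = LinearMap.range ι
  d : Ω →ₗ[ℂ] Ω
  d_mem : ∀ {n : ℕ} {x : Ω}, x ∈ deg n → d x ∈ deg (n + 1)
  d_d : ∀ x : Ω, d (d x) = 0
  leibniz : ∀ {n : ℕ} {x : Ω}, x ∈ deg n → ∀ y : Ω,
    d (x * y) = d x * y + ((-1 : ℂ) ^ n) • (x * d y)
  da_mul : ∀ a y : A, d (ι a) * ι y = d (ι (a * y)) - ι a * d (ι y)
  deg_one : deg 1 = Submodule.span ℂ
    ({x | ∃ a : A, x = d (ι a)} ∪ {x | ∃ a b : A, x = ι a * d (ι b)})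
  deg_succ : ∀ n : ℕ, deg (n + 2) =
    Submodule.span ℂ {x | ∃ ω ∈ deg (n + 1), ∃ a : A, x = ω * d (ι a)}

attribute [instance] Forms.ringΩ Forms.modΩ Forms.smulCommΩ Forms.towerΩ

namespace Forms

variable {A : Type} [NonUnitalRing A] [Module ℂ A] [SMulCommClass ℂ A A] [IsScalarTower ℂ A A]

/-- The word `d a₁ ⋯ d aₙ`, as an element of the unitization of `Ω A` (the empty word
being the adjoined unit). -/
noncomputable def wordU (F : Forms A) (l : List A) : Unitization ℂ F.Ω :=
  (l.map fun a => (Unitization.inr (F.d (F.ι a)) : Unitization ℂ F.Ω)).prod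

/-- The word `d a₁ d b₁ ⋯ d aₙ d bₙ` of even length, as an element of the unitization
of `Ω A`. -/
noncomputable def wordU2 (F : Forms A) (l : List (A × A)) : Unitization ℂ F.Ω :=
  (l.map fun q => (Unitization.inr (F.d (F.ι q.1) * F.d (F.ι q.2)) : Unitization ℂ F.Ω)).prod

/-- The even part `Ω^{even} A = ⊕ₙ Ω^{2n} A`; endowed with the Fedosov product
`x ⊙ y = x·y − dx·dy` it is the tensor algebra `T A`. -/
def evenPart (F : Forms A) : Submodule ℂ F.Ω := ⨆ n : ℕ, F.deg (2 * n)

end Forms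

/-- The subspace `Fₙ(A) = b(Ω^{n+1} A) ⊕ ⊕_{j ≥ n+1} Ω^j A` of the Hodge filtration. -/
noncomputable def Forms.hodge {A : Type} [NonUnitalRing A] [Module ℂ A]
    [SMulCommClass ℂ A A] [IsScalarTower ℂ A A]
    (F : Forms A) (b : Module.End ℂ F.Ω) (n : ℕ) : Submodule ℂ F.Ω :=
  Submodule.map (b : F.Ω →ₗ[ℂ] F.Ω) (F.deg (n + 1)) ⊔ ⨆ j : ℕ, ⨆ _ : n + 1 ≤ j, F.deg j

namespace Forms

variable {A : Type} [NonUnitalRing A] [Module ℂ A] [SMulCommClass ℂ A A] [IsScalarTower ℂ A A]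

theorem ι_mem (F : Forms A) (a : A) : F.ι a ∈ F.deg 0 := by
  rw [F.deg_zero]
  exact ⟨a, rfl⟩

theorem dι_mem (F : Forms A) (a : A) : F.d (F.ι a) ∈ F.deg 1 := F.d_mem (F.ι_mem a)

theorem mul_ι_mem (F : Forms A) {m : ℕ} {x : F.Ω} (hx : x ∈ F.deg m) (a : A) :
    x * F.ι a ∈ F.deg m := F.mul_mem' hx (F.ι_mem a)

theorem ι_mul_mem (F : Forms A) {m : ℕ} {x : F.Ω} (hx : x ∈ F.deg m) (a : A) :
    F.ι a * x ∈ F.deg m := by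
  simpa using F.mul_mem' (F.ι_mem a) hx

theorem mul_dι_mul_ι (F : Forms A) (ω : F.Ω) (a c : A) :
    ω * F.d (F.ι a) * F.ι c = ω * F.d (F.ι (a * c)) - ω * F.ι a * F.d (F.ι c) := by
  rw [mul_assoc, F.da_mul, mul_sub, mul_assoc]

/-- Linear maps agreeing on the forms `ω da` agree in degrees at least two. -/
theorem eqOn_deg_succ (F : Forms A) {m : ℕ} (f g : F.Ω →ₗ[ℂ] F.Ω)
    (h : ∀ ω ∈ F.deg (m + 1), ∀ a : A, f (ω * F.d (F.ι a)) = g (ω * F.d (F.ι a)))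
    {x : F.Ω} (hx : x ∈ F.deg (m + 2)) : f x = g x := by
  rw [F.deg_succ] at hx
  refine LinearMap.eqOn_span (f := f) (g := g) ?_ hx
  rintro _ ⟨ω, hω, a, rfl⟩
  exact h ω hω a

/-- Linear maps agreeing on the forms `da` and `ω da` agree in positive degrees. -/
theorem eqOn_deg_pos (F : Forms A) {m : ℕ} (f g : F.Ω →ₗ[ℂ] F.Ω)
    (hd : ∀ a : A, f (F.d (F.ι a)) = g (F.d (F.ι a)))
    (h : ∀ k : ℕ, ∀ ω ∈ F.deg k, ∀ a : A, f (ω * F.d (F.ι a)) = g (ω * F.d (F.ι a)))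
    {x : F.Ω} (hx : x ∈ F.deg (m + 1)) : f x = g x := by
  cases m with
  | zero =>
    rw [F.deg_one] at hx
    refine LinearMap.eqOn_span (f := f) (g := g) ?_ hx
    rintro _ (⟨a, rfl⟩ | ⟨a, c, rfl⟩)
    · exact hd a
    · exact h 0 _ (F.ι_mem a) c
  | succ m => exact F.eqOn_deg_succ f g (h (m + 1)) hx

theorem mem_of_forall_deg (F : Forms A) (p : Submodule ℂ F.Ω) (h : ∀ j, F.deg j ≤ p)
    (x : F.Ω) : x ∈ p := by
  have : (⊤ : Submodule ℂ F.Ω) ≤ p := F.internal.submodule_iSup_eq_top ▸ iSup_le h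
  exact this trivial

/-- The Hochschild boundary identifies `ω a` and `a ω` for `ω` of positive degree. -/
theorem boundary_mul_ι (F : Forms A) (b : Module.End ℂ F.Ω)
    (hb_d : ∀ a : A, b (F.d (F.ι a)) = 0)
    (hb_form : ∀ (m : ℕ) (ω : F.Ω), ω ∈ F.deg m → ∀ a : A,
      b (ω * F.d (F.ι a)) = ((-1 : ℂ) ^ m) • (ω * F.ι a - F.ι a * ω))
    {m : ℕ} {ω : F.Ω} (hω : ω ∈ F.deg (m + 1)) (c : A) :
    b (ω * F.ι c) = b (F.ι c * ω) := by
  refine F.eqOn_deg_pos (b ∘ₗ LinearMap.mulRight ℂ (F.ι c)) (b ∘ₗ LinearMap.mulLeft ℂ (F.ι c))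
    (fun a => ?_) (fun k η hη a => ?_) hω
  · simp only [LinearMap.comp_apply, LinearMap.mulRight_apply, LinearMap.mulLeft_apply]
    rw [F.da_mul, map_sub, hb_d, hb_form 0 _ (F.ι_mem a), hb_form 0 _ (F.ι_mem c)]
    simp
  · simp only [LinearMap.comp_apply, LinearMap.mulRight_apply, LinearMap.mulLeft_apply]
    rw [F.mul_dι_mul_ι, ← mul_assoc, map_sub, hb_form k _ hη, hb_form k _ (F.mul_ι_mem hη a),
      hb_form k _ (F.ι_mul_mem hη c), ← smul_sub, F.ι_mul]
    congr 1
    noncomm_ring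

/-- The Hochschild boundary squares to zero. -/
theorem boundary_boundary (F : Forms A) (b : Module.End ℂ F.Ω)
    (hb_mem : ∀ (m : ℕ) (x : F.Ω), x ∈ F.deg (m + 1) → b x ∈ F.deg m)
    (hb_zero : ∀ x ∈ F.deg 0, b x = 0)
    (hb_d : ∀ a : A, b (F.d (F.ι a)) = 0)
    (hb_form : ∀ (m : ℕ) (ω : F.Ω), ω ∈ F.deg m → ∀ a : A,
      b (ω * F.d (F.ι a)) = ((-1 : ℂ) ^ m) • (ω * F.ι a - F.ι a * ω))
    (x : F.Ω) : b (b x) = 0 := by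
  refine F.mem_of_forall_deg (LinearMap.ker (b ∘ₗ b)) (fun j y hy => ?_) x
  rw [LinearMap.mem_ker, LinearMap.comp_apply]
  match j, hy with
  | 0, hy => rw [hb_zero y hy, map_zero]
  | 1, hy => exact hb_zero _ (hb_mem 0 y hy)
  | m + 2, hy =>
    refine F.eqOn_deg_succ (b ∘ₗ b) 0 (fun ω hω a => ?_) hy
    rw [LinearMap.comp_apply, hb_form _ ω hω, map_smul, map_sub,
      F.boundary_mul_ι b hb_d hb_form hω, sub_self, smul_zero, LinearMap.zero_apply]

/-- The extension of a connection to degrees `≥ n` raises the degree by one. -/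
theorem connection_mem (F : Forms A) {n : ℕ} (hn : 1 ≤ n) (N : Module.End ℂ F.Ω)
    (hN_mem : ∀ ω ∈ F.deg n, N ω ∈ F.deg (n + 1))
    (hN_ext : ∀ (j : ℕ), n ≤ j → ∀ x ∈ F.deg j, ∀ a : A,
      N (x * F.d (F.ι a)) = N x * F.d (F.ι a))
    {j : ℕ} (hj : n ≤ j) : ∀ x ∈ F.deg j, N x ∈ F.deg (j + 1) := by
  induction j, hj using Nat.le_induction with
  | base => exact hN_mem
  | succ j hj ih =>
    obtain ⟨m, rfl⟩ := Nat.exists_eq_add_of_le' (hn.trans hj)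
    intro x hx
    rw [F.deg_succ] at hx
    refine Submodule.span_le (p := (F.deg (m + 1 + 1 + 1)).comap N) |>.mpr ?_ hx
    rintro _ ⟨ω, hω, a, rfl⟩
    rw [SetLike.mem_coe, Submodule.mem_comap, hN_ext _ hj ω hω]
    exact F.mul_mem' (ih ω hω) (F.dι_mem a)

/-- The extension of a left linear connection is left linear. -/
theorem connection_ι_mul (F : Forms A) {n : ℕ} (hn : 1 ≤ n) (N : Module.End ℂ F.Ω)
    (hN_left : ∀ (a : A), ∀ ω ∈ F.deg n, N (F.ι a * ω) = F.ι a * N ω)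
    (hN_ext : ∀ (j : ℕ), n ≤ j → ∀ x ∈ F.deg j, ∀ a : A,
      N (x * F.d (F.ι a)) = N x * F.d (F.ι a))
    {j : ℕ} (hj : n ≤ j) (c : A) : ∀ x ∈ F.deg j, N (F.ι c * x) = F.ι c * N x := by
  induction j, hj using Nat.le_induction with
  | base => exact hN_left c
  | succ j hj ih =>
    obtain ⟨m, rfl⟩ := Nat.exists_eq_add_of_le' (hn.trans hj)
    intro x hx
    refine F.eqOn_deg_succ (N ∘ₗ LinearMap.mulLeft ℂ (F.ι c)) (LinearMap.mulLeft ℂ (F.ι c) ∘ₗ N)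
      (fun ω hω a => ?_) hx
    simp only [LinearMap.comp_apply, LinearMap.mulLeft_apply]
    rw [← mul_assoc, hN_ext _ hj _ (F.ι_mul_mem hω c), hN_ext _ hj ω hω, ih ω hω, mul_assoc]

/-- The extension of a connection satisfies the right Leibniz rule in all degrees `≥ n`. -/
theorem connection_mul_ι (F : Forms A) {n : ℕ} (hn : 1 ≤ n) (N : Module.End ℂ F.Ω)
    (hN_right : ∀ (a : A), ∀ ω ∈ F.deg n,
      N (ω * F.ι a) = N ω * F.ι a + ((-1 : ℂ) ^ n) • (ω * F.d (F.ι a)))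
    (hN_ext : ∀ (j : ℕ), n ≤ j → ∀ x ∈ F.deg j, ∀ a : A,
      N (x * F.d (F.ι a)) = N x * F.d (F.ι a))
    {j : ℕ} (hj : n ≤ j) : ∀ (c : A), ∀ x ∈ F.deg j,
      N (x * F.ι c) = N x * F.ι c + ((-1 : ℂ) ^ j) • (x * F.d (F.ι c)) := by
  induction j, hj using Nat.le_induction with
  | base => exact hN_right
  | succ j hj ih =>
    obtain ⟨m, rfl⟩ := Nat.exists_eq_add_of_le' (hn.trans hj)
    intro c x hx
    refine F.eqOn_deg_succ (N ∘ₗ LinearMap.mulRight ℂ (F.ι c))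
      (LinearMap.mulRight ℂ (F.ι c) ∘ₗ N
        + ((-1 : ℂ) ^ (m + 1 + 1)) • LinearMap.mulRight ℂ (F.d (F.ι c)))
      (fun ω hω a => ?_) hx
    simp only [LinearMap.comp_apply, LinearMap.mulRight_apply, LinearMap.add_apply,
      LinearMap.smul_apply]
    rw [F.mul_dι_mul_ι, map_sub, hN_ext _ hj ω hω, hN_ext _ hj _ (F.mul_ι_mem hω a),
      hN_ext _ hj ω hω, ih a ω hω, F.mul_dι_mul_ι, add_mul, smul_mul_assoc, pow_succ _ (m + 1),
      mul_neg_one, neg_smul]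
    abel

/-- The operator `[b, ∇]` is the identity in degrees `> n`. -/
theorem commutator_eq_self (F : Forms A) {n : ℕ} (hn : 1 ≤ n) (b N : Module.End ℂ F.Ω)
    (hb_form : ∀ (m : ℕ) (ω : F.Ω), ω ∈ F.deg m → ∀ a : A,
      b (ω * F.d (F.ι a)) = ((-1 : ℂ) ^ m) • (ω * F.ι a - F.ι a * ω))
    (hN_mem : ∀ ω ∈ F.deg n, N ω ∈ F.deg (n + 1))
    (hN_left : ∀ (a : A), ∀ ω ∈ F.deg n, N (F.ι a * ω) = F.ι a * N ω)
    (hN_right : ∀ (a : A), ∀ ω ∈ F.deg n,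
      N (ω * F.ι a) = N ω * F.ι a + ((-1 : ℂ) ^ n) • (ω * F.d (F.ι a)))
    (hN_ext : ∀ (j : ℕ), n ≤ j → ∀ x ∈ F.deg j, ∀ a : A,
      N (x * F.d (F.ι a)) = N x * F.d (F.ι a))
    {j : ℕ} (hj : n + 1 ≤ j) {x : F.Ω} (hx : x ∈ F.deg j) : (b * N + N * b) x = x := by
  obtain ⟨m, rfl⟩ := Nat.exists_eq_add_of_le' ((Nat.succ_le_succ hn).trans hj)
  have hm : n ≤ m + 1 := by omega
  refine F.eqOn_deg_succ (b * N + N * b) LinearMap.id (fun ω hω a => ?_) hx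
  rw [LinearMap.add_apply, Module.End.mul_apply, Module.End.mul_apply, hN_ext _ hm ω hω,
    hb_form _ _ (F.connection_mem hn N hN_mem hN_ext hm ω hω), hb_form _ ω hω, map_smul, map_sub,
    F.connection_mul_ι hn N hN_right hN_ext hm a ω hω,
    F.connection_ι_mul hn N hN_left hN_ext hm a ω hω, pow_succ _ (m + 1), mul_neg_one, neg_smul,
    ← sub_eq_neg_add, ← smul_sub, LinearMap.id_apply, add_sub_right_comm, add_sub_cancel_left,
    smul_smul, ← mul_pow, neg_one_mul, neg_neg, one_pow, one_smul]

end Forms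

/-- Let `∇ : Ωⁿ A → Ω^{n+1} A` be a graded right connection
(`∇(a·ω) = a·∇ω`, `∇(ω·a) = ∇(ω)·a + (−1)ⁿ ω da`), extended to all of `Ω A` by
`∇(ω da_{n+1} ⋯ da_j) = ∇(ω) da_{n+1} ⋯ da_j` and by `0` in degrees `< n`.  Then
`[b, ∇] = b∇ + ∇b` is an idempotent operator on `Ω A` with range exactly `Fₙ(A)`;
it is the identity on `Fₙ(A)`, and its kernel is a `b`-invariant linear complement of
`Fₙ(A)`. -/
theorem connection_idempotent_hodge
    {A : Type} [NonUnitalRing A] [Module ℂ A] [SMulCommClass ℂ A A] [IsScalarTower ℂ A A]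
    (F : Forms A) (n : ℕ) (hn : 1 ≤ n) (b N : Module.End ℂ F.Ω)
    (hb_mem : ∀ (m : ℕ) (x : F.Ω), x ∈ F.deg (m + 1) → b x ∈ F.deg m)
    (hb_zero : ∀ x ∈ F.deg 0, b x = 0)
    (hb_d : ∀ a : A, b (F.d (F.ι a)) = 0)
    (hb_form : ∀ (m : ℕ) (ω : F.Ω), ω ∈ F.deg m → ∀ a : A,
      b (ω * F.d (F.ι a)) = ((-1 : ℂ) ^ m) • (ω * F.ι a - F.ι a * ω))
    (hN_low : ∀ j : ℕ, j < n → ∀ x ∈ F.deg j, N x = 0)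
    (hN_mem : ∀ ω ∈ F.deg n, N ω ∈ F.deg (n + 1))
    (hN_left : ∀ (a : A), ∀ ω ∈ F.deg n, N (F.ι a * ω) = F.ι a * N ω)
    (hN_right : ∀ (a : A), ∀ ω ∈ F.deg n,
      N (ω * F.ι a) = N ω * F.ι a + ((-1 : ℂ) ^ n) • (ω * F.d (F.ι a)))
    (hN_ext : ∀ (j : ℕ), n ≤ j → ∀ x ∈ F.deg j, ∀ a : A,
      N (x * F.d (F.ι a)) = N x * F.d (F.ι a)) :
    IsIdempotentElem (b * N + N * b) ∧
    LinearMap.range (b * N + N * b) = F.hodge b n ∧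
    (∀ x ∈ F.hodge b n, (b * N + N * b) x = x) ∧
    IsCompl (LinearMap.ker (b * N + N * b)) (F.hodge b n) ∧
    (∀ x ∈ LinearMap.ker (b * N + N * b), b x ∈ LinearMap.ker (b * N + N * b)) := by
  have hbb := F.boundary_boundary b hb_mem hb_zero hb_d hb_form
  have hhigh {j : ℕ} (hj : n + 1 ≤ j) {x : F.Ω} (hx : x ∈ F.deg j) : (b * N + N * b) x = x :=
    F.commutator_eq_self hn b N hb_form hN_mem hN_left hN_right hN_ext hj hx
  have hcomm (x : F.Ω) : (b * N + N * b) (b x) = b ((b * N + N * b) x) := by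
    simp [hbb]
  have hNb {j : ℕ} (hj : j ≤ n) {x : F.Ω} (hx : x ∈ F.deg j) : N (b x) = 0 := by
    cases j with
    | zero => rw [hb_zero x hx, map_zero]
    | succ j => exact hN_low j hj _ (hb_mem j x hx)
  have hproj : LinearMap.IsProj (F.hodge b n) (b * N + N * b) := by
    constructor
    · refine F.mem_of_forall_deg ((F.hodge b n).comap (b * N + N * b)) fun j x hx => ?_
      rw [Submodule.mem_comap]
      rcases lt_trichotomy j n with hj | rfl | hj
      · rw [LinearMap.add_apply, Module.End.mul_apply, Module.End.mul_apply, hNb hj.le hx,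
          hN_low j hj x hx, map_zero, add_zero]
        exact zero_mem _
      · rw [LinearMap.add_apply, Module.End.mul_apply, Module.End.mul_apply, hNb le_rfl hx,
          add_zero]
        exact Submodule.mem_sup_left (Submodule.mem_map_of_mem (hN_mem x hx))
      · rw [hhigh hj hx]
        exact Submodule.mem_sup_right
          (Submodule.mem_iSup_of_mem j (Submodule.mem_iSup_of_mem hj hx))
    · have hle : F.hodge b n ≤ LinearMap.eqLocus (b * N + N * b) LinearMap.id := by
        refine sup_le ?_ (iSup₂_le fun j hj x hx => hhigh hj hx)
        rintro _ ⟨y, hy, rfl⟩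
        exact (hcomm y).trans (congrArg b (hhigh le_rfl hy))
      exact fun x hx => hle hx
  refine ⟨hproj.isIdempotentElem, hproj.range, hproj.map_id, hproj.isCompl.symm, fun x hx => ?_⟩
  rw [LinearMap.mem_ker] at hx ⊢
  rw [hcomm, hx, map_zero]
end

section
/- Let B be an associative, not necessarily unital, ℂ-algebra with unitization B̃, and apply the Ω-construction to the algebra B̃ (so that in Ω(B̃) the unit 1 of B̃ is an ordinary algebra element and d1 ≠ 0). Let V ⊆ Ω¹(B̃) be the linear span of the elements x̃·d1 with x̃ ∈ (B̃)~ and dx − 1·dx with x ∈ B̃. Then: (a) Ω¹(B̃) = ι(Ω¹B) ⊕ V as vector spaces; (b) b(Ω²(B̃)) = b(Ω²B) + V as subspaces of Ω¹(B̃). Consequently ι induces a linear isomorphism Ω¹B / b(Ω²B) ≅ Ω¹(B̃) / b(Ω²(B̃)), i.e. the odd parts of the X-complexes of B and B̃ are canonically isomorphic. -/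
open scoped TensorProduct

noncomputable section

variable (B : Type) [NonUnitalRing B] [Module ℂ B] [SMulCommClass ℂ B B] [IsScalarTower ℂ B B]

/-- `Ω¹C := C̃ ⊗ C` with elementary tensors `x̃ ⊗ y` written `x̃ Dy`. -/
abbrev Omega1 (C : Type) [NonUnitalRing C] [Module ℂ C]
    [SMulCommClass ℂ C C] [IsScalarTower ℂ C C] : Type :=
  (Unitization ℂ C) ⊗[ℂ] C

/-- The inclusion `C → C̃` as a linear map. -/
def inrLin (C : Type) [AddCommGroup C] [Module ℂ C] : C →ₗ[ℂ] Unitization ℂ C where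
  toFun := Unitization.inr
  map_add' x y := Unitization.inr_add ℂ x y
  map_smul' c x := Unitization.inr_smul ℂ c x

/-- The unital embedding `B̃ → (B̃)~` (sending the adjoined unit of `B̃` to the adjoined
unit of `(B̃)~` and `B` into `B̃` via `inr`). -/
def unitalIncl : Unitization ℂ B →ₐ[ℂ] Unitization ℂ (Unitization ℂ B) :=
  Unitization.lift
    ((Unitization.inrNonUnitalAlgHom ℂ (Unitization ℂ B)).comp
      (Unitization.inrNonUnitalAlgHom ℂ B))

/-- The natural inclusion `ι : Ω¹B → Ω¹(B̃)`. -/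
def iotaMap : Omega1 B →ₗ[ℂ] Omega1 (Unitization ℂ B) :=
  TensorProduct.map (unitalIncl B).toLinearMap (inrLin B)

/-- The subspace `V ⊆ Ω¹(B̃)` spanned by the `x̃·d1` (`x̃ ∈ (B̃)~`) and the `dx − 1·dx`
(`x ∈ B̃`); here `d y = 1 D y` and `1 ∈ B̃ ⊆ (B̃)~`. -/
def Vsub : Submodule ℂ (Omega1 (Unitization ℂ B)) :=
  Submodule.span ℂ
    ({v | ∃ x : Unitization ℂ (Unitization ℂ B), v = x ⊗ₜ[ℂ] (1 : Unitization ℂ B)} ∪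
      {v | ∃ x : Unitization ℂ B,
        v = ((1 : Unitization ℂ (Unitization ℂ B)) -
              Unitization.inr (1 : Unitization ℂ B)) ⊗ₜ[ℂ] x})

/-- `b(Ω²C) ⊆ Ω¹C`: the span of the elements
`b(x̃ dc da) = ±(x̃ D(ca) − (x̃c) Da − (ax̃) Dc)`. -/
def bSpan (C : Type) [NonUnitalRing C] [Module ℂ C]
    [SMulCommClass ℂ C C] [IsScalarTower ℂ C C] : Submodule ℂ (Omega1 C) :=
  Submodule.span ℂ
    {v | ∃ (x : Unitization ℂ C) (c a : C),
      v = x ⊗ₜ[ℂ] (c * a) - (x * Unitization.inr c) ⊗ₜ[ℂ] a -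
            (Unitization.inr a * x) ⊗ₜ[ℂ] c}

/-- The retraction `(B̃)~ → B̃` of `unitalIncl`, identifying the formal unit with `1 ∈ B̃`. -/
def unitalRetract : Unitization ℂ (Unitization ℂ B) →ₐ[ℂ] Unitization ℂ B :=
  Unitization.lift (NonUnitalAlgHom.id ℂ (Unitization ℂ B))

/-- The projection `Ω¹(B̃) → Ω¹B` along `V`. -/
def omegaRetract : Omega1 (Unitization ℂ B) →ₗ[ℂ] Omega1 B :=
  TensorProduct.map (unitalRetract B).toLinearMap (Unitization.sndHom (R := ℂ) ℂ B)

variable {B}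

@[simp] lemma unitalIncl_inr (b : B) :
    unitalIncl B (Unitization.inr b) = Unitization.inr (Unitization.inr b) := by
  simp [unitalIncl]

@[simp] lemma unitalRetract_inr (x : Unitization ℂ B) :
    unitalRetract B (Unitization.inr x) = x := by
  simp [unitalRetract]

@[simp] lemma unitalRetract_unitalIncl (x : Unitization ℂ B) :
    unitalRetract B (unitalIncl B x) = x := by
  induction x using Unitization.ind with
  | inl_add_inr r b =>
    rw [← Unitization.algebraMap_eq_inl, map_add, map_add, AlgHom.commutes, AlgHom.commutes,
      unitalIncl_inr, unitalRetract_inr]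

@[simp] lemma unitalRetract_one :
    unitalRetract B (1 : Unitization ℂ (Unitization ℂ B)) = 1 := by
  ext <;> simp [unitalRetract]

lemma sub_unitalIncl_unitalRetract (x : Unitization ℂ (Unitization ℂ B)) :
    x - unitalIncl B (unitalRetract B x) = -(x.snd.fst • (1 - Unitization.inr 1)) := by
  induction x using Unitization.ind with
  | inl_add_inr r y =>
    induction y using Unitization.ind with
    | inl_add_inr t b =>
      rw [← Unitization.algebraMap_eq_inl, map_add, map_add, AlgHom.commutes, AlgHom.commutes,
        unitalRetract_inr, map_add, unitalIncl_inr, ← Unitization.algebraMap_eq_inl,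
        AlgHom.commutes]
      simp only [Algebra.algebraMap_eq_smul_one]
      ext <;> simp [sub_eq_add_neg]

@[simp] lemma iotaMap_tmul (x : Unitization ℂ B) (b : B) :
    iotaMap B (x ⊗ₜ b) = unitalIncl B x ⊗ₜ Unitization.inr b := rfl

@[simp] lemma omegaRetract_tmul (x : Unitization ℂ (Unitization ℂ B)) (y : Unitization ℂ B) :
    omegaRetract B (x ⊗ₜ y) = unitalRetract B x ⊗ₜ y.snd := rfl

@[simp] lemma omegaRetract_iotaMap (v : Omega1 B) : omegaRetract B (iotaMap B v) = v := by
  induction v using TensorProduct.induction_on with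
  | zero => simp
  | tmul x b => simp
  | add v w hv hw => rw [map_add, map_add, hv, hw]

lemma Vsub_le_ker_omegaRetract : Vsub B ≤ LinearMap.ker (omegaRetract B) := by
  rw [Vsub, Submodule.span_le]
  rintro _ (⟨x, rfl⟩ | ⟨x, rfl⟩) <;> simp

lemma sub_iotaMap_omegaRetract_mem (w : Omega1 (Unitization ℂ B)) :
    w - iotaMap B (omegaRetract B w) ∈ Vsub B := by
  induction w using TensorProduct.induction_on with
  | zero => simp
  | add v w hv hw =>
    rw [map_add, map_add, add_sub_add_comm]
    exact add_mem hv hw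
  | tmul x y =>
    have hy : y = y.fst • (1 : Unitization ℂ B) + Unitization.inr y.snd := by ext <;> simp
    have key : x ⊗ₜ[ℂ] y - iotaMap B (omegaRetract B (x ⊗ₜ y)) =
        y.fst • (x ⊗ₜ[ℂ] (1 : Unitization ℂ B)) +
        (x - unitalIncl B (unitalRetract B x)) ⊗ₜ[ℂ]
          (Unitization.inr y.snd : Unitization ℂ B) := by
      rw [omegaRetract_tmul, iotaMap_tmul]
      conv_lhs => rw [hy]
      simp only [TensorProduct.tmul_add, TensorProduct.sub_tmul, TensorProduct.tmul_smul,
        Unitization.snd_add, Unitization.snd_smul, Unitization.snd_one, Unitization.snd_inr,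
        smul_zero, zero_add]
      abel
    rw [key, sub_unitalIncl_unitalRetract, TensorProduct.neg_tmul, ← TensorProduct.smul_tmul']
    refine add_mem (Submodule.smul_mem _ _ ?_) (neg_mem (Submodule.smul_mem _ _ ?_))
    · exact Submodule.subset_span (Or.inl ⟨x, rfl⟩)
    · exact Submodule.subset_span (Or.inr ⟨_, rfl⟩)

lemma bSpan_le_comap_iotaMap : bSpan B ≤ (bSpan (Unitization ℂ B)).comap (iotaMap B) := by
  rw [bSpan, Submodule.span_le]
  rintro _ ⟨x, c, a, rfl⟩
  refine Submodule.subset_span ⟨unitalIncl B x, Unitization.inr c, Unitization.inr a, ?_⟩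
  simp

lemma bSpan_le_comap_omegaRetract :
    bSpan (Unitization ℂ B) ≤ (bSpan B).comap (omegaRetract B) := by
  rw [bSpan, Submodule.span_le]
  rintro _ ⟨x, c, a, rfl⟩
  refine Submodule.subset_span ⟨unitalRetract B x, c.snd, a.snd, ?_⟩
  have split (z : Unitization ℂ B) :
      z = z.fst • (1 : Unitization ℂ B) + Unitization.inr z.snd := by ext <;> simp
  have hc : unitalRetract B x * c =
      c.fst • unitalRetract B x + unitalRetract B x * Unitization.inr c.snd := by
    conv_lhs => rw [split c]
    rw [mul_add, mul_smul_comm, mul_one]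
  have ha : a * unitalRetract B x =
      a.fst • unitalRetract B x + Unitization.inr a.snd * unitalRetract B x := by
    conv_lhs => rw [split a]
    rw [add_mul, smul_mul_assoc, one_mul]
  simp only [map_sub, omegaRetract_tmul, map_mul, unitalRetract_inr, hc, ha,
    Unitization.snd_mul, TensorProduct.tmul_add, TensorProduct.add_tmul,
    TensorProduct.tmul_smul, ← TensorProduct.smul_tmul']
  abel

lemma Vsub_le_bSpan : Vsub B ≤ bSpan (Unitization ℂ B) := by
  have gen (x : Unitization ℂ (Unitization ℂ B)) (c a : Unitization ℂ B) :
      x ⊗ₜ[ℂ] (c * a) - (x * Unitization.inr c) ⊗ₜ[ℂ] a - (Unitization.inr a * x) ⊗ₜ[ℂ] c ∈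
        bSpan (Unitization ℂ B) := Submodule.subset_span ⟨x, c, a, rfl⟩
  have comm (x : Unitization ℂ (Unitization ℂ B)) :
      Unitization.inr 1 * x = x * Unitization.inr 1 := by ext <;> simp
  have idem (x : Unitization ℂ (Unitization ℂ B)) :
      x * Unitization.inr 1 * Unitization.inr 1 = x * Unitization.inr 1 := by ext <;> simp
  have tmul_one_mem (x : Unitization ℂ (Unitization ℂ B)) :
      x ⊗ₜ[ℂ] (1 : Unitization ℂ B) ∈ bSpan (Unitization ℂ B) := by
    have h := gen x 1 1
    have h' := gen (x * Unitization.inr 1) 1 1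
    rw [comm, mul_one] at h h'
    rw [idem] at h'
    convert sub_mem h (add_mem h' h') using 1
    abel
  rw [Vsub, Submodule.span_le]
  rintro _ (⟨x, rfl⟩ | ⟨y, rfl⟩)
  · exact tmul_one_mem x
  · have h := add_mem (gen 1 1 y) (tmul_one_mem (Unitization.inr y * 1))
    rw [sub_add_cancel, one_mul, one_mul, ← TensorProduct.sub_tmul] at h
    exact h

variable (B)

/-- (a) `Ω¹(B̃) = ι(Ω¹B) ⊕ V` as vector spaces;
(b) `b(Ω²(B̃)) = ι(b(Ω²B)) + V` inside `Ω¹(B̃)`.  Consequently `ι` induces a linear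
isomorphism `Ω¹B / b(Ω²B) ≅ Ω¹(B̃) / b(Ω²(B̃))`: the odd parts of the X-complexes of `B`
and of its unitization `B̃` are canonically isomorphic. -/
theorem unitization_X_complex_odd_part :
    IsCompl (LinearMap.range (iotaMap B)) (Vsub B) ∧
    bSpan (Unitization ℂ B) = Submodule.map (iotaMap B) (bSpan B) ⊔ Vsub B ∧
    ∃ e : (Omega1 B ⧸ bSpan B) ≃ₗ[ℂ]
        (Omega1 (Unitization ℂ B) ⧸ bSpan (Unitization ℂ B)),
      ∀ v : Omega1 B,
        e (Submodule.Quotient.mk v) = Submodule.Quotient.mk (iotaMap B v) := by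
  refine ⟨⟨?_, ?_⟩, ?_, ?_⟩
  · rw [Submodule.disjoint_def]
    rintro _ ⟨v, rfl⟩ hv
    have h := Vsub_le_ker_omegaRetract hv
    rw [LinearMap.mem_ker, omegaRetract_iotaMap] at h
    rw [h, map_zero]
  · rw [codisjoint_iff, eq_top_iff]
    intro w _
    rw [← add_sub_cancel (iotaMap B (omegaRetract B w)) w]
    exact Submodule.add_mem_sup ⟨_, rfl⟩ (sub_iotaMap_omegaRetract_mem w)
  · refine le_antisymm (fun w hw => ?_)
      (sup_le (Submodule.map_le_iff_le_comap.mpr bSpan_le_comap_iotaMap) Vsub_le_bSpan)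
    rw [← add_sub_cancel (iotaMap B (omegaRetract B w)) w]
    exact Submodule.add_mem_sup (Submodule.mem_map_of_mem (bSpan_le_comap_omegaRetract hw))
      (sub_iotaMap_omegaRetract_mem w)
  · refine ⟨LinearEquiv.ofLinearMap
      (Submodule.mapQ _ _ (iotaMap B) bSpan_le_comap_iotaMap)
      (Submodule.mapQ _ _ (omegaRetract B) bSpan_le_comap_omegaRetract) ?_ ?_, fun v => rfl⟩
    · refine Submodule.linearMap_qext _ (LinearMap.ext fun w => ?_)
      refine ((Submodule.Quotient.eq _).mpr ?_).symm
      exact Vsub_le_bSpan (sub_iotaMap_omegaRetract_mem w)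
    · refine Submodule.linearMap_qext _ (LinearMap.ext fun v => ?_)
      exact congrArg Submodule.Quotient.mk (omegaRetract_iotaMap v)
end
end

section
/- Let V be a complex Banach space and (p_n) a sequence of continuous linear operators on V such that sup_n ‖p_n‖ < ∞ and p_n(v) → v for every v in some dense subset of V. Let S be a set of compact continuous linear operators on V that is totally bounded with respect to the operator norm. Then sup_{T ∈ S} ‖T − p_n ∘ T‖ → 0 as n → ∞; that is, for every ε > 0 there is N such that ‖T − p_n ∘ T‖ ≤ ε for all n ≥ N and all T ∈ S. -/
open Filter

/-- A uniformly bounded family of continuous linear maps that converges to zero pointwise on a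
dense set converges to zero at every point. -/
theorem tendsto_zero_of_dense_of_norm_le {ι 𝕜 E F : Type*} [NontriviallyNormedField 𝕜]
    [SeminormedAddCommGroup E] [NormedSpace 𝕜 E] [SeminormedAddCommGroup F] [NormedSpace 𝕜 F]
    {l : Filter ι} {f : ι → E →L[𝕜] F} {M : ℝ} (hM : ∀ i, ‖f i‖ ≤ M) {D : Set E} (hD : Dense D)
    (hf : ∀ x ∈ D, Tendsto (fun i => f i x) l (nhds 0)) (x : E) :
    Tendsto (fun i => f i x) l (nhds 0) := by
  rw [Metric.tendsto_nhds]
  intro ε hε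
  have hpos : 0 < |M| + 1 := by positivity
  obtain ⟨y, hy, hxy⟩ := hD.exists_dist_lt x (ε := ε / 2 / (|M| + 1)) (by positivity)
  filter_upwards [Metric.tendsto_nhds.1 (hf y hy) (ε / 2) (half_pos hε)] with i hi
  rw [dist_zero_right] at hi ⊢
  rw [dist_eq_norm, lt_div_iff₀ hpos] at hxy
  have hle : ‖f i (x - y)‖ ≤ (|M| + 1) * ‖x - y‖ :=
    (f i).le_of_opNorm_le (by linarith [hM i, le_abs_self M]) _
  have hadd : f i x = f i (x - y) + f i y := by rw [← map_add, sub_add_cancel]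
  rw [hadd]
  linarith [norm_add_le (f i (x - y)) (f i y)]

/-- A uniformly bounded family of continuous linear maps that converges to zero pointwise on a
totally bounded set converges to zero uniformly on it. -/
theorem TotallyBounded.eventually_forall_norm_apply_le {ι 𝕜 E F : Type*}
    [NontriviallyNormedField 𝕜] [SeminormedAddCommGroup E] [NormedSpace 𝕜 E]
    [SeminormedAddCommGroup F] [NormedSpace 𝕜 F]
    {l : Filter ι} {f : ι → E →L[𝕜] F} {M : ℝ} (hM : ∀ i, ‖f i‖ ≤ M) {K : Set E}
    (hK : TotallyBounded K) (hf : ∀ x ∈ K, Tendsto (fun i => f i x) l (nhds 0))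
    {ε : ℝ} (hε : 0 < ε) : ∀ᶠ i in l, ∀ x ∈ K, ‖f i x‖ ≤ ε := by
  have hpos : 0 < |M| + 1 := by positivity
  obtain ⟨t, htK, htfin, hcover⟩ :=
    Metric.finite_approx_of_totallyBounded hK (ε / 2 / (|M| + 1)) (by positivity)
  have ht : ∀ᶠ i in l, ∀ y ∈ t, dist (f i y) 0 < ε / 2 :=
    (eventually_all_finite htfin).2 fun y hy =>
      Metric.tendsto_nhds.1 (hf y (htK hy)) (ε / 2) (half_pos hε)
  filter_upwards [ht] with i hi x hx
  obtain ⟨y, hy, hxy⟩ := Set.mem_iUnion₂.1 (hcover hx)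
  have hiy := hi y hy
  rw [dist_zero_right] at hiy
  rw [Metric.mem_ball, dist_eq_norm, lt_div_iff₀ hpos] at hxy
  have hle : ‖f i (x - y)‖ ≤ (|M| + 1) * ‖x - y‖ :=
    (f i).le_of_opNorm_le (by linarith [hM i, le_abs_self M]) _
  have hadd : f i x = f i (x - y) + f i y := by rw [← map_add, sub_add_cancel]
  rw [hadd]
  linarith [norm_add_le (f i (x - y)) (f i y)]

/-- Composing a compact operator with a uniformly bounded family of continuous linear maps that
converges to zero pointwise gives a family that converges to zero in operator norm. -/
theorem IsCompactOperator.tendsto_comp_zero {ι 𝕜 E F G : Type*} [RCLike 𝕜]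
    [NormedAddCommGroup E] [NormedSpace 𝕜 E] [NormedAddCommGroup F] [NormedSpace 𝕜 F]
    [NormedAddCommGroup G] [NormedSpace 𝕜 G] {T : E →L[𝕜] F} (hT : IsCompactOperator T)
    {l : Filter ι} {f : ι → F →L[𝕜] G} {M : ℝ} (hM : ∀ i, ‖f i‖ ≤ M)
    (hf : ∀ x, Tendsto (fun i => f i x) l (nhds 0)) :
    Tendsto (fun i => (f i).comp T) l (nhds 0) := by
  rw [Metric.tendsto_nhds]
  intro ε hε
  have hK : TotallyBounded (T '' Metric.closedBall 0 1) :=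
    (IsCompactOperator.isCompact_closure_image_closedBall (f := (T : E →ₗ[𝕜] F))
      hT 1).totallyBounded.subset subset_closure
  filter_upwards [hK.eventually_forall_norm_apply_le hM (fun x _ => hf x) (half_pos hε)] with i hi
  rw [dist_zero_right]
  refine lt_of_le_of_lt ?_ (half_lt_self hε)
  refine ContinuousLinearMap.opNorm_le_of_unit_norm (half_pos hε).le fun x hx => ?_
  exact hi _ (Set.mem_image_of_mem _ (by simp [hx]))

/-- Let `V` be a complex Banach space and `(p n)` a sequence of continuous
linear operators on `V` with uniformly bounded operator norms converging pointwise to the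
identity on a dense subset.  If `S` is a set of compact operators which is totally bounded
for the operator norm, then `‖T - p n ∘ T‖ → 0` uniformly for `T ∈ S`. -/
theorem cutoff_tendsto_uniformly_on_compact_operators
    {V : Type*} [NormedAddCommGroup V] [NormedSpace ℂ V] [CompleteSpace V]
    (p : ℕ → V →L[ℂ] V) (C : ℝ) (hC : ∀ n, ‖p n‖ ≤ C)
    (D : Set V) (hD : Dense D)
    (hconv : ∀ v ∈ D, Tendsto (fun n => p n v) atTop (nhds v))
    (S : Set (V →L[ℂ] V)) (hcomp : ∀ T ∈ S, IsCompactOperator T)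
    (hTB : TotallyBounded S) :
    ∀ ε > (0 : ℝ), ∃ N : ℕ, ∀ n ≥ N, ∀ T ∈ S, ‖T - (p n).comp T‖ ≤ ε := by
  intro ε hε
  set q : ℕ → V →L[ℂ] V := fun n => ContinuousLinearMap.id ℂ V - p n with hq
  have hqM : ∀ n, ‖q n‖ ≤ 1 + C := fun n =>
    (norm_sub_le _ _).trans <| add_le_add ContinuousLinearMap.norm_id_le (hC n)
  have hq0 : ∀ v, Tendsto (fun n => q n v) atTop (nhds 0) :=
    tendsto_zero_of_dense_of_norm_le hqM hD fun v hv => by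
      simpa [hq] using (hconv v hv).const_sub v
  have hcompM : ∀ n, ‖ContinuousLinearMap.compL ℂ V V V (q n)‖ ≤ 1 + C := fun n =>
    ((ContinuousLinearMap.compL ℂ V V V).le_of_opNorm_le
      (ContinuousLinearMap.norm_compL_le ℂ V V V) (q n)).trans (by simpa using hqM n)
  obtain ⟨N, hN⟩ := eventually_atTop.1 <| hTB.eventually_forall_norm_apply_le hcompM
    (fun T hT => (hcomp T hT).tendsto_comp_zero hqM hq0) hε
  refine ⟨N, fun n hn T hT => ?_⟩
  simpa [hq, ContinuousLinearMap.sub_comp] using hN n hn T hT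
end
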